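/- arXiv:2604.01307 — 7 statements merged into one kernel-verified Lean document; each statement's English description precedes it below -/
import Mathlib

section
/- For all natural numbers k and L with k ≥ 1 and 2k ≤ L, the number of strings over a four-letter alphabet {s, 1, 2, 3} that have length at most L and contain at most k−1 characters from {1, 2, 3} is at most 2 · 3^k · C(L,k). Equivalently, ∑_{i=0}^{L} ∑_{j=0}^{min(i,k−1)} C(i,j) · 3^j ≤ 2 · 3^k · C(L,k). -/
theorem Nat.choose_le_choose_of_le_half {n a b : ℕ} (hab : a ≤ b) (hb : 2 * b ≤ n) :
    n.choose a ≤ n.choose b := by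
  induction b, hab using Nat.le_induction with
  | base => exact le_rfl
  | succ b _ ih =>
    exact (ih (by omega)).trans (Nat.choose_le_succ_of_lt_half_left (by omega))

theorem Nat.sum_range_succ_choose_right (n j : ℕ) :
    ∑ i ∈ Finset.range (n + 1), i.choose j = (n + 1).choose (j + 1) := by
  induction n with
  | zero => cases j <;> simp [Nat.choose_eq_zero_of_lt]
  | succ n ih => rw [Finset.sum_range_succ, ih, Nat.choose_succ_succ (n + 1) j, add_comm]

theorem Nat.sum_range_three_pow_le (k : ℕ) : ∑ j ∈ Finset.range k, 3 ^ j ≤ 3 ^ k := by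
  induction k with
  | zero => simp
  | succ k ih => rw [Finset.sum_range_succ, pow_succ]; omega

open Finset in
/-- The number of strings over the four-letter alphabet `{s,1,2,3}` that have
length at most `L` and contain at most `k-1` characters from `{1,2,3}` is
`∑_{i=0}^{L} ∑_{j=0}^{min(i,k-1)} C(i,j)·3^j`; this is at most `2·3^k·C(L,k)`. -/
theorem stmt3 (k L : ℕ) (hk : 1 ≤ k) (hL : 2 * k ≤ L) :
    ∑ i ∈ Finset.range (L + 1), ∑ j ∈ Finset.range (min i (k - 1) + 1),
        i.choose j * 3 ^ j ≤ 2 * 3 ^ k * L.choose k := by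
  calc
    _ ≤ ∑ i ∈ range (L + 1), ∑ j ∈ range k, i.choose j * 3 ^ j := by
      refine sum_le_sum fun i _ => sum_le_sum_of_subset (range_subset_range.2 ?_)
      omega
    _ = ∑ j ∈ range k, (L + 1).choose (j + 1) * 3 ^ j := by
      rw [sum_comm]
      simp_rw [← sum_mul, Nat.sum_range_succ_choose_right]
    _ ≤ ∑ j ∈ range k, 2 * L.choose k * 3 ^ j := by
      refine sum_le_sum fun j hj => Nat.mul_le_mul_right _ ?_
      have hjk : j < k := mem_range.1 hj
      rw [Nat.choose_succ_succ, two_mul]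
      exact add_le_add (Nat.choose_le_choose_of_le_half hjk.le hL)
        (Nat.choose_le_choose_of_le_half hjk hL)
    _ = 2 * L.choose k * ∑ j ∈ range k, 3 ^ j := (mul_sum ..).symm
    _ ≤ 2 * L.choose k * 3 ^ k := Nat.mul_le_mul_left _ (Nat.sum_range_three_pow_le k)
    _ = 2 * 3 ^ k * L.choose k := by ring
end

section
/- For all natural numbers k and L with k ≥ 1 and 2k ≤ L + 1, the inequality ∑_{j=0}^{k−1} 3^j · C(L+1, j+1) ≤ 3^k · C(L+1, k) holds. -/
theorem stmt4 (k L : ℕ) (hk : 1 ≤ k) (hL : 2 * k ≤ L + 1) :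
    ∑ j ∈ Finset.range k, 3 ^ j * (L + 1).choose (j + 1) ≤
      3 ^ k * (L + 1).choose k := by
  clear hk
  induction k with
  | zero => simp
  | succ k ih =>
    have h : (L + 1).choose k ≤ (L + 1).choose (k + 1) :=
      Nat.choose_le_succ_of_lt_half_left (by omega)
    calc ∑ j ∈ Finset.range (k + 1), 3 ^ j * (L + 1).choose (j + 1)
        ≤ 3 ^ k * (L + 1).choose k + 3 ^ k * (L + 1).choose (k + 1) := by
          rw [Finset.sum_range_succ]
          exact Nat.add_le_add_right (ih (by omega)) _
      _ = 3 ^ k * ((L + 1).choose k + (L + 1).choose (k + 1)) := by ring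
      _ ≤ 3 ^ k * (3 * (L + 1).choose (k + 1)) := by
          gcongr
          omega
      _ = 3 ^ (k + 1) * (L + 1).choose (k + 1) := by ring
end

section
/- Let L and k be natural numbers and let F be a finite set of strings over a two-letter alphabet {a, u} such that every string in F has length at most L and contains at most k occurrences of the letter a, and no string in F is a prefix of another string in F (in particular the strings in F are pairwise distinct). Then |F| ≤ ∑_{j=0}^{k} C(L,j). -/
theorem card_filter_getD_le_count_true (w : List Bool) (L : ℕ) :
    ((Finset.range L).filter fun i => w.getD i false = true).card ≤ w.count true := by
  induction w generalizing L with
  | nil => simp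
  | cons b w ih =>
    cases L with
    | zero => simp
    | succ L =>
      have h := ih L
      rw [Finset.card_filter] at h ⊢
      rw [Finset.sum_range_succ']
      cases b <;> simpa using h

theorem isPrefix_of_getD_eq {w w' : List Bool} (hle : w.length ≤ w'.length)
    (h : ∀ i < w.length, w.getD i false = w'.getD i false) : w <+: w' := by
  rw [List.prefix_iff_getElem]
  refine ⟨hle, fun i hi => ?_⟩
  have := h i hi
  rwa [List.getD_eq_getElem _ _ hi, List.getD_eq_getElem _ _ (hi.trans_le hle)] at this

/-- A family of strings over the two-letter alphabet `Bool` (`true` playing the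
role of the letter `a`, `false` the role of `u`), each of length at most `L`
and with at most `k` occurrences of `a`, in which no string is a prefix of
another, has size at most `∑_{j=0}^{k} C(L,j)`. -/
theorem stmt5 (L k : ℕ) (F : Finset (List Bool))
    (hlen : ∀ w ∈ F, w.length ≤ L)
    (hcount : ∀ w ∈ F, w.count true ≤ k)
    (hpref : ∀ w ∈ F, ∀ w' ∈ F, w ≠ w' → ¬ w <+: w') :
    F.card ≤ ∑ j ∈ Finset.range (k + 1), L.choose j := by
  have hcard : ((Finset.range (k + 1)).biUnion fun j =>
      (Finset.range L).powersetCard j).card ≤ ∑ j ∈ Finset.range (k + 1), L.choose j := by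
    simpa using Finset.card_biUnion_le (s := Finset.range (k + 1))
      (t := fun j => (Finset.range L).powersetCard j)
  refine le_trans (Finset.card_le_card_of_injOn
    (fun w => (Finset.range L).filter fun i => w.getD i false = true) ?_ ?_) hcard
  · intro w hw
    have h := (card_filter_getD_le_count_true w L).trans (hcount w hw)
    rw [Finset.mem_coe, Finset.mem_biUnion]
    exact ⟨_, Finset.mem_range.2 (Nat.lt_succ_of_le h),
      Finset.mem_powersetCard.2 ⟨Finset.filter_subset _ _, rfl⟩⟩
  · intro w hw w' hw' heq
    have hget : ∀ i < L, w.getD i false = w'.getD i false := by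
      intro i hi
      rw [Bool.eq_iff_iff]
      exact Finset.filter_inj'.1 heq (Finset.mem_range.2 hi)
    by_contra hne
    rcases le_total w.length w'.length with hle | hle
    · exact hpref w hw w' hw' hne <| isPrefix_of_getD_eq hle
        fun i hi => hget i (hi.trans_le (hlen w hw))
    · exact hpref w' hw' w hw (Ne.symm hne) <| isPrefix_of_getD_eq hle
        fun i hi => (hget i (hi.trans_le (hlen w' hw'))).symm
end

section
/- Let p be a string of natural numbers and m a natural number with m < |p|, and let s1 and s2 be the first and second signpost strings of p with respect to m. For every string s of natural numbers with LCP(s,p) = m and s < p in lexicographic order, it holds that s1 ≤ s < s2. -/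
/-- Longest common prefix length of two strings. -/
def lcp : List ℕ → List ℕ → ℕ
  | a :: s, b :: t => if a = b then lcp s t + 1 else 0
  | _, _ => 0

/-- First signpost string: the first `m` characters of `p`. -/
def signpost1 (p : List ℕ) (m : ℕ) : List ℕ := p.take m

/-- Second signpost string: the first `m+1` characters of `p`. -/
def signpost2 (p : List ℕ) (m : ℕ) : List ℕ := p.take (m + 1)

/-- Third signpost string: the first `m+1` characters of `p` with the
`(m+1)`-st character (1-indexed) replaced by `p[m+1] + 1`. -/
def signpost3 (p : List ℕ) (m : ℕ) : List ℕ :=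
  (p.take (m + 1)).set m (p.getD m 0 + 1)

/-- Fourth signpost string: the first `m` characters of `p` with the
`m`-th character (1-indexed) replaced by `p[m] + 1`. -/
def signpost4 (p : List ℕ) (m : ℕ) : List ℕ :=
  (p.take m).set (m - 1) (p.getD (m - 1) 0 + 1)

/-- `[]` is the least string. -/
theorem nil_le_string (s : List ℕ) : [] ≤ s := by
  rw [← not_lt]
  exact List.not_lt_nil s

theorem take_lcp_le (s p : List ℕ) : p.take (lcp s p) ≤ s := by
  induction s generalizing p with
  | nil => simp [lcp]
  | cons a s ih =>
    cases p with
    | nil => simpa using nil_le_string (a :: s)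
    | cons b t =>
      by_cases hab : a = b
      · subst hab
        have h := ih t
        rw [← not_lt] at h ⊢
        simpa only [lcp, if_true, List.take_succ_cons, List.cons_lt_cons_iff, lt_irrefl,
          true_and, false_or] using h
      · simpa [lcp, hab] using nil_le_string (a :: s)

theorem lt_take_lcp_succ (s p : List ℕ) (hlt : s < p) : s < p.take (lcp s p + 1) := by
  induction s generalizing p with
  | nil =>
    cases p with
    | nil => simp at hlt
    | cons b t => simp
  | cons a s ih =>
    cases p with
    | nil => simp at hlt
    | cons b t =>
      by_cases hab : a = b
      · subst hab
        simp only [List.cons_lt_cons_iff, lt_irrefl, true_and, false_or] at hlt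
        simpa [lcp, List.cons_lt_cons_iff] using ih t hlt
      · simpa [lcp, hab, List.cons_lt_cons_iff] using hlt

theorem stmt8 (p : List ℕ) (m : ℕ) (hm : m < p.length)
    (s : List ℕ) (hlcp : lcp s p = m) (hlt : s < p) :
    signpost1 p m ≤ s ∧ s < signpost2 p m := by
  subst hlcp
  exact ⟨take_lcp_le s p, lt_take_lcp_succ s p hlt⟩
end

section
/- Let p be a string of natural numbers and m a natural number with m < |p|, and let s2 and s3 be the second and third signpost strings of p with respect to m. For every string s of natural numbers with LCP(s,p) ≥ m+1, it holds that s2 ≤ s < s3 in lexicographic order. -/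
theorem not_lt_take_of_le_lcp (n : ℕ) (s p : List ℕ) (h : n ≤ lcp s p) : ¬ s < p.take n := by
  induction n generalizing s p with
  | zero => simp
  | succ n ih =>
    match s, p with
    | [], _ => simp [lcp] at h
    | _ :: _, [] => simp
    | a :: s, b :: p =>
      by_cases hab : a = b
      · subst hab
        simp only [lcp, if_true, Nat.add_le_add_iff_right] at h
        simpa [List.cons_lt_cons_iff] using ih s p h
      · simp [lcp, hab] at h

theorem lt_set_take_of_lt_lcp (m : ℕ) (s p : List ℕ) (h : m < lcp s p) :
    s < (p.take (m + 1)).set m (p.getD m 0 + 1) := by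
  induction m generalizing s p with
  | zero =>
    match s, p with
    | [], _ => simp [lcp] at h
    | _ :: _, [] => simp [lcp] at h
    | a :: s, b :: p =>
      by_cases hab : a = b
      · simp [List.cons_lt_cons_iff, hab]
      · simp [lcp, hab] at h
  | succ m ih =>
    match s, p with
    | [], _ => simp [lcp] at h
    | _ :: _, [] => simp [lcp] at h
    | a :: s, b :: p =>
      by_cases hab : a = b
      · subst hab
        simp only [lcp, if_true, Nat.add_lt_add_iff_right] at h
        simpa [List.cons_lt_cons_iff] using ih s p h
      · simp [lcp, hab] at h

theorem stmt9 (p : List ℕ) (m : ℕ) (hm : m < p.length)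
    (s : List ℕ) (hlcp : m + 1 ≤ lcp s p) :
    signpost2 p m ≤ s ∧ s < signpost3 p m := by
  exact ⟨not_lt.mp (not_lt_take_of_le_lcp (m + 1) s p hlcp), lt_set_take_of_lt_lcp m s p hlcp⟩
end

section
/- Let p be a string of natural numbers and m a natural number with 1 ≤ m < |p|, and let s3 and s4 be the third and fourth signpost strings of p with respect to m. For every string s of natural numbers with LCP(s,p) = m and s > p in lexicographic order, it holds that s3 ≤ s < s4. -/
theorem signpost3_cons_succ (b : ℕ) (t : List ℕ) (k : ℕ) :
    signpost3 (b :: t) (k + 1) = b :: signpost3 t k := by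
  simp [signpost3]

theorem signpost4_cons_succ_succ (b : ℕ) (t : List ℕ) (k : ℕ) :
    signpost4 (b :: t) (k + 2) = b :: signpost4 t (k + 1) := by
  simp [signpost4]

theorem signpost3_lcp_le (p s : List ℕ) (hm : lcp s p < p.length) (hgt : p < s) :
    signpost3 p (lcp s p) ≤ s := by
  induction p generalizing s with
  | nil => simp at hm
  | cons b t ih =>
    cases s with
    | nil => simp at hgt
    | cons a s =>
      rw [List.cons_lt_cons_iff] at hgt
      by_cases hab : a = b
      · subst hab
        simp only [lcp, if_true, List.length_cons, Nat.add_lt_add_iff_right] at hm ⊢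
        have hts : t < s := by simpa using hgt
        rw [signpost3_cons_succ, ← not_lt, List.cons_lt_cons_iff]
        rintro (h | ⟨-, h⟩)
        · exact lt_irrefl a h
        · exact not_lt_of_ge (ih s hm hts) h
      · have hba : b < a := by omega
        simp only [lcp, if_neg hab]
        simp only [signpost3, List.take_succ_cons, List.take_zero, List.set_cons_zero,
          List.getD_cons_zero]
        rw [← not_lt, List.cons_lt_cons_iff]
        rintro (h | ⟨-, h⟩)
        · omega
        · exact List.not_lt_nil s h

theorem lt_signpost4_lcp (p s : List ℕ) (hpos : 1 ≤ lcp s p) :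
    s < signpost4 p (lcp s p) := by
  induction p generalizing s with
  | nil => cases s <;> simp [lcp] at hpos
  | cons b t ih =>
    cases s with
    | nil => simp [lcp] at hpos
    | cons a s =>
      by_cases hab : a = b
      · subst hab
        simp only [lcp, if_true]
        have ih := ih s
        generalize lcp s t = k at ih ⊢
        cases k with
        | zero => simp [signpost4, List.cons_lt_cons_iff]
        | succ k =>
          rw [signpost4_cons_succ_succ, List.cons_lt_cons_iff]
          exact Or.inr ⟨rfl, ih (by omega)⟩
      · simp [lcp, hab] at hpos

theorem stmt10 (p : List ℕ) (m : ℕ) (hm1 : 1 ≤ m) (hm : m < p.length)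
    (s : List ℕ) (hlcp : lcp s p = m) (hgt : p < s) :
    signpost3 p m ≤ s ∧ s < signpost4 p m := by
  subst hlcp
  exact ⟨signpost3_lcp_le p s hm hgt, lt_signpost4_lcp p s hm1⟩
end

section
/- Let p be a string of natural numbers and m a natural number with 1 ≤ m ≤ |p|, and let s1 and s4 be the first and fourth signpost strings of p with respect to m. For every string s of natural numbers with LCP(s,p) < m, it holds that either s < s1 or s ≥ s4 in lexicographic order. -/
/-- Lexicographic comparison of two nonempty strings. -/
theorem cons_le_cons_iff_lt_or_eq_and_le (a b : ℕ) (s t : List ℕ) :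
    a :: s ≤ b :: t ↔ a < b ∨ a = b ∧ s ≤ t := by
  have h : b :: t < a :: s ↔ b < a ∨ b = a ∧ t < s := List.cons_lt_cons_iff
  rw [← not_lt (a := b :: t), ← not_lt (a := t), h]
  rcases lt_trichotomy a b with hab | rfl | hab
  · simp [hab, hab.ne', hab.le]
  · simp
  · simp [hab, hab.ne', hab.le]

theorem stmt11 (p : List ℕ) (m : ℕ) (hm1 : 1 ≤ m) (hm : m ≤ p.length)
    (s : List ℕ) (hlcp : lcp s p < m) :
    s < signpost1 p m ∨ signpost4 p m ≤ s := by
  induction p generalizing m s with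
  | nil => simp at hm; omega
  | cons a p ih =>
    obtain ⟨n, rfl⟩ := Nat.exists_eq_add_of_le' hm1
    cases s with
    | nil => exact Or.inl (by simp [signpost1])
    | cons b s =>
      rcases lt_trichotomy b a with hba | rfl | hab
      · exact Or.inl (by simp [signpost1, List.cons_lt_cons_iff, hba])
      · have hrec : lcp s p < n := by simpa [lcp] using hlcp
        obtain ⟨k, rfl⟩ := Nat.exists_eq_add_of_lt (Nat.zero_lt_of_lt hrec)
        have h := ih _ (by omega) (by simpa using hm) s hrec
        simpa [signpost1, signpost4, List.cons_lt_cons_iff, cons_le_cons_iff_lt_or_eq_and_le] using h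
      · right
        cases n with
        | zero =>
          rcases Nat.lt_or_eq_of_le (Nat.succ_le_of_lt hab) with h | rfl
          · simp [signpost4, cons_le_cons_iff_lt_or_eq_and_le, h]
          · simp [signpost4, ← not_lt]
        | succ k => simp [signpost4, cons_le_cons_iff_lt_or_eq_and_le, hab]
end
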